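/- Let L be a finite-dimensional semisimple Lie algebra over ℝ and let φ : L → L be a Lie algebra automorphism with φ ∘ φ = id, with +1-eigenspace L₀ and −1-eigenspace L₁. Then every nonzero element e ∈ L₁ such that ad(e) is a nilpotent endomorphism of L can be embedded in a homogeneous sl₂-triple: there exist h ∈ L₀ and f ∈ L₁ with ⁅h,e⁆ = 2•e, ⁅h,f⁆ = (−2)•f and ⁅e,f⁆ = h. -/

import Mathlib

section

attribute [local instance] LieRing.ofAssociativeRing

open LieAlgebra

/-- The Kleinecke–Shirokov identity: if `E` commutes with `⁅E, Z⁆`, then applying the inner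
derivation `ad E` to `Z ^ n` exactly `n` times gives `n! • ⁅E, Z⁆ ^ n`, and once more gives `0`. -/
theorem ad_pow_pow_of_lie_lie_eq_zero {K A : Type*} [CommRing K] [Ring A] [Algebra K A]
    {E Z : A} (hEZ : ⁅E, ⁅E, Z⁆⁆ = 0) (n : ℕ) :
    (ad K A E ^ n) (Z ^ n) = n.factorial • ⁅E, Z⁆ ^ n ∧ (ad K A E ^ (n + 1)) (Z ^ n) = 0 := by
  have leibniz : ∀ (k : ℕ) (X : A), (ad K A E ^ (k + 1)) (X * Z) =
      (ad K A E ^ (k + 1)) X * Z + (k + 1) • ((ad K A E ^ k) X * ⁅E, Z⁆) := by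
    have hmul (X Y : A) : ⁅E, X * Y⁆ = ⁅E, X⁆ * Y + X * ⁅E, Y⁆ := by
      simp only [Ring.lie_def]; noncomm_ring
    have hsucc (k : ℕ) (X : A) : (ad K A E ^ (k + 1)) X = ⁅E, (ad K A E ^ k) X⁆ := by
      rw [pow_succ', Module.End.mul_apply, ad_apply]
    intro k X
    induction k with
    | zero => simp [hmul]
    | succ k ih =>
      rw [hsucc, ih, lie_add, lie_nsmul, hmul, hmul, hEZ, hsucc (k + 1), ← hsucc k, mul_zero,
        add_zero, succ_nsmul _ (k + 1)]
      abel
  induction n with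
  | zero => simp [Ring.lie_def]
  | succ n ih =>
    constructor
    · rw [pow_succ Z, leibniz, ih.1, ih.2, zero_mul, zero_add, smul_mul_assoc, smul_smul,
        ← pow_succ, Nat.factorial_succ]
    · rw [pow_succ Z, leibniz, ih.2, pow_succ', Module.End.mul_apply, ih.2]
      simp

/-- If a nilpotent `E` commutes with `⁅E, Z⁆`, then `⁅E, Z⁆` is nilpotent. -/
theorem isNilpotent_lie_of_lie_lie_eq_zero (K : Type*) {A : Type*} [Field K] [CharZero K]
    [Ring A] [Algebra K A] {E Z : A} (hE : IsNilpotent E) (hEZ : ⁅E, ⁅E, Z⁆⁆ = 0) :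
    IsNilpotent ⁅E, Z⁆ := by
  obtain ⟨n, hn⟩ := ad_nilpotent_of_nilpotent (R := K) hE
  refine ⟨n, ?_⟩
  have h := (ad_pow_pow_of_lie_lie_eq_zero (K := K) hEZ n).1
  rw [hn, LinearMap.zero_apply, ← Nat.cast_smul_eq_nsmul K] at h
  exact (smul_eq_zero.mp h.symm).resolve_left (by exact_mod_cast n.factorial_ne_zero)

/-- If a nilpotent `E` commutes with `⁅E, Z⁆`, then `E * Z` is nilpotent. -/
theorem isNilpotent_mul_of_lie_lie_eq_zero (K : Type*) {A : Type*} [Field K] [CharZero K]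
    [Ring A] [Algebra K A] {E Z : A} (hE : IsNilpotent E) (hEZ : ⁅E, ⁅E, Z⁆⁆ = 0) :
    IsNilpotent (E * Z) := by
  obtain ⟨m, hm⟩ := isNilpotent_lie_of_lie_lie_eq_zero K hE hEZ
  obtain ⟨N, hN⟩ := hE
  set W := ⁅E, Z⁆ with hW
  have hEW : E * W = W * E := sub_eq_zero.mp (by rw [← Ring.lie_def, hEZ])
  have hEZ' : E * Z = Z * E + W := by rw [hW, Ring.lie_def]; abel
  have hpow : ∀ k : ℕ, E ^ (k + 1) * Z = Z * E ^ (k + 1) + (k + 1) • (W * E ^ k) := by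
    intro k
    induction k with
    | zero => simpa using hEZ'
    | succ k ih =>
      rw [pow_succ' E (k + 1), mul_assoc, ih, mul_add, ← mul_assoc, hEZ', mul_smul_comm,
        ← mul_assoc, hEW, succ_nsmul _ (k + 1), pow_succ' E k]
      simp only [add_mul, mul_assoc]
      abel
  have hker : ∀ (j : ℕ) (X : A), E ^ (j + 1) * X = 0 → ∀ n : ℕ,
      E ^ (j + 1) * ((E * Z) ^ n * X) = 0 ∧
      E ^ j * ((E * Z) ^ n * X) = (j + 1) ^ n • (W ^ n * (E ^ j * X)) := by
    intro j X hX n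
    have hstep (Y : A) (hY : E ^ (j + 1) * Y = 0) :
        E ^ j * (E * Z * Y) = (j + 1) • (W * (E ^ j * Y)) := by
      rw [← mul_assoc, ← mul_assoc, ← pow_succ, hpow, add_mul, mul_assoc, hY, mul_zero, zero_add,
        smul_mul_assoc, mul_assoc]
    induction n with
    | zero => simpa using hX
    | succ n ih =>
      rw [pow_succ' (E * Z), mul_assoc]
      constructor
      · rw [pow_succ', mul_assoc, hstep _ ih.1, mul_smul_comm, ← mul_assoc, hEW, mul_assoc,
          ← mul_assoc E, ← pow_succ', ih.1]
        simp
      · rw [hstep _ ih.1, ih.2, mul_smul_comm, smul_smul, ← pow_succ', ← mul_assoc, ← pow_succ']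
  have hdesc : ∀ j (X : A), E ^ j * X = 0 → (E * Z) ^ (m * j) * X = 0 := by
    intro j
    induction j with
    | zero => intro X hX; simpa using hX
    | succ j ih =>
      intro X hX
      rw [Nat.mul_succ, pow_add, mul_assoc]
      refine ih _ ?_
      rw [(hker j X hX m).2, hm]
      simp
  exact ⟨m * N, by simpa using hdesc N 1 (by simp [hN])⟩

variable {K L : Type*} [Field K] [CharZero K] [LieRing L] [LieAlgebra K L] [FiniteDimensional K L]

/-- In a Lie algebra with nondegenerate Killing form, an `ad`-nilpotent element `e` lies in the
image of `(ad e) ^ 2`. -/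
theorem exists_lie_lie_eq_self_of_isNilpotent_ad [IsKilling K L] {e : L}
    (hnil : IsNilpotent (ad K L e)) : ∃ y : L, ⁅e, ⁅e, y⁆⁆ = e := by
  by_contra! hne
  have hmem : e ∉ LinearMap.range (ad K L e ^ 2) := by
    rintro ⟨y, hy⟩
    exact hne y (by simpa [pow_two] using hy)
  obtain ⟨g, hge, hg⟩ := Submodule.exists_le_ker_of_notMem hmem
  obtain ⟨z, hz⟩ : ∃ z, killingForm K L z = g := by
    have hinj : Function.Injective (killingForm K L) :=
      LinearMap.ker_eq_bot.mp (IsKilling.ker_killingForm_eq_bot K L)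
    exact (LinearMap.injective_iff_surjective_of_finrank_eq_finrank
      Subspace.dual_finrank_eq.symm).mp hinj g
  have hez : ⁅e, ⁅e, z⁆⁆ = 0 := by
    have hker : killingForm K L ⁅e, ⁅e, z⁆⁆ = 0 := by
      ext y
      have hy : killingForm K L z ⁅e, ⁅e, y⁆⁆ = 0 := by
        rw [hz]
        exact hg ⟨y, by simp [pow_two]⟩
      rw [LinearMap.zero_apply, LieModule.traceForm_apply_lie_apply',
        LieModule.traceForm_apply_lie_apply', neg_neg, hy]
    simpa using (show ⁅e, ⁅e, z⁆⁆ ∈ LinearMap.ker (killingForm K L) from hker)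
  have hprod : IsNilpotent (ad K L e * ad K L z) := by
    refine isNilpotent_mul_of_lie_lie_eq_zero K hnil ?_
    rw [← LieHom.map_lie, ← LieHom.map_lie, hez, map_zero]
  apply hge
  rw [← hz, LieModule.traceForm_comm]
  exact (LinearMap.isNilpotent_trace_of_isNilpotent hprod).eq_zero

/-- Morozov's lemma: if `⁅h, e⁆ = 2 • e` and `h = ⁅e, f₀⁆` for an `ad`-nilpotent `e`, then `h` and
`e` can be completed to an `sl₂`-triple. -/
theorem exists_sl2_triple_of_lie_eq {e h f₀ : L} (hnil : IsNilpotent (ad K L e))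
    (he : ⁅h, e⁆ = (2 : K) • e) (hf₀ : ⁅e, f₀⁆ = h) :
    ∃ f : L, ⁅h, f⁆ = (-2 : K) • f ∧ ⁅e, f⁆ = h := by
  obtain ⟨N, hN⟩ := hnil
  set E := ad K L e with hE
  set H := ad K L h with hH
  set F := ad K L f₀ with hF
  have hHE : H * E = E * H + (2 : K) • E := by
    rw [← sub_eq_iff_eq_add', ← Ring.lie_def, ← LieHom.map_lie, he, map_smul]
  have hEF : E * F = F * E + H := by
    rw [← sub_eq_iff_eq_add', ← Ring.lie_def, ← LieHom.map_lie, hf₀]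
  have hcomm : ∀ n : ℕ, E ^ (n + 1) * F =
      F * E ^ (n + 1) + ((n + 1 : ℕ) : K) • ((H - (n : K) • 1) * E ^ n) := by
    intro n
    induction n with
    | zero => simpa using hEF
    | succ n ih =>
      have hEH : E * H = H * E - (2 : K) • E := by rw [hHE]; abel
      rw [pow_succ' E (n + 1), mul_assoc, ih, mul_add, ← mul_assoc, hEF, mul_smul_comm,
        ← mul_assoc, mul_sub, hEH, pow_succ' E n]
      simp only [sub_mul, add_mul, smul_mul_assoc, mul_smul_comm, mul_one, one_mul, mul_assoc]
      push_cast
      module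
  have hmaps : ∀ x ∈ LinearMap.ker E, (H + (2 : K) • 1) x ∈ LinearMap.ker E := by
    intro x hx
    have hEx : E x = 0 := hx
    have h := LinearMap.congr_fun hHE x
    simp only [Module.End.mul_apply, LinearMap.add_apply, LinearMap.smul_apply, hEx, map_zero,
      smul_zero, add_zero] at h
    simp [hEx, ← h]
  have hinj : Function.Injective ((H + (2 : K) • 1).restrict hmaps) := by
    rw [injective_iff_map_eq_zero]
    rintro ⟨x, hx⟩ hx0
    have hHx : H x = (-2 : K) • x := by
      have := congr_arg Subtype.val hx0
      rw [neg_smul, ← add_eq_zero_iff_eq_neg]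
      simpa using this
    have hEx : E x = 0 := hx
    have hrange : ∀ n : ℕ, ∃ w, (E ^ n) w = x := by
      intro n
      induction n with
      | zero => exact ⟨x, by simp⟩
      | succ n ih =>
        obtain ⟨w, hw⟩ := ih
        have hc := LinearMap.congr_fun (hcomm n) w
        have hEw : (E ^ (n + 1)) w = 0 := by rw [pow_succ', Module.End.mul_apply, hw, hEx]
        simp only [Module.End.mul_apply, LinearMap.add_apply, LinearMap.smul_apply,
          LinearMap.sub_apply, Module.End.one_apply, hw, hEw, hHx, map_zero, zero_add] at hc
        set c : K := ((n + 1 : ℕ) : K) * (-((n + 2 : ℕ) : K)) with hcdef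
        have hc0 : c ≠ 0 := mul_ne_zero (by exact_mod_cast n.succ_ne_zero)
          (neg_ne_zero.mpr (by exact_mod_cast (n + 1).succ_ne_zero))
        have hcx : (E ^ (n + 1)) (F w) = c • x := by
          rw [hc, hcdef]
          push_cast
          module
        exact ⟨c⁻¹ • F w, by rw [map_smul, hcx, inv_smul_smul₀ hc0]⟩
    obtain ⟨w, hw⟩ := hrange N
    ext
    simp [← hw, hN]
  have hmem : ⁅h, f₀⁆ + (2 : K) • f₀ ∈ LinearMap.ker E := by
    have heh : ⁅e, h⁆ = -((2 : K) • e) := by rw [← lie_skew, he]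
    rw [LinearMap.mem_ker, hE, ad_apply, lie_add, lie_smul, leibniz_lie, heh, hf₀, lie_self,
      neg_lie, smul_lie, hf₀]
    simp
  obtain ⟨⟨g, hg⟩, hgeq⟩ := LinearMap.injective_iff_surjective.mp hinj ⟨_, hmem⟩
  have hgeq' : ⁅h, g⁆ + (2 : K) • g = ⁅h, f₀⁆ + (2 : K) • f₀ := by
    simpa [hH] using congr_arg Subtype.val hgeq
  have hg' : ⁅e, g⁆ = 0 := hg
  refine ⟨f₀ - g, ?_, by rw [lie_sub, hf₀, hg', sub_zero]⟩
  rw [lie_sub, eq_sub_of_add_eq hgeq']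
  module

end

/-- Let `L` be a finite-dimensional semisimple Lie algebra over `ℝ` (semisimplicity is encoded
by the nondegeneracy of the Killing form, `LieAlgebra.IsKilling`), and let `φ` be an involutive
automorphism of `L`.  Every nonzero `e` with `φ e = −e` (i.e. `e ∈ L₁`) whose adjoint action is
nilpotent embeds in a homogeneous `sl₂`-triple: there are `h` with `φ h = h` (i.e. `h ∈ L₀`) and
`f` with `φ f = −f` (i.e. `f ∈ L₁`) such that `⁅h,e⁆ = 2•e`, `⁅h,f⁆ = (−2)•f`, `⁅e,f⁆ = h`. -/
theorem exists_homogeneous_sl2_triple_real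
    (L : Type*) [LieRing L] [LieAlgebra ℝ L] [FiniteDimensional ℝ L]
    [LieAlgebra.IsKilling ℝ L]
    (φ : L →ₗ⁅ℝ⁆ L) (hφ : ∀ x, φ (φ x) = x)
    (e : L) (he : e ≠ 0) (heφ : φ e = -e)
    (hnil : IsNilpotent (LieAlgebra.ad ℝ L e)) :
    ∃ h f : L, φ h = h ∧ φ f = -f ∧
      ⁅h, e⁆ = (2 : ℝ) • e ∧ ⁅h, f⁆ = (-2 : ℝ) • f ∧ ⁅e, f⁆ = h := by
  obtain ⟨y, hy⟩ := exists_lie_lie_eq_self_of_isNilpotent_ad hnil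
  have hy' : ⁅e, ⁅e, φ y⁆⁆ = -e := by
    rw [← heφ, ← congr_arg φ hy, LieHom.map_lie, LieHom.map_lie, heφ, neg_lie, neg_lie, lie_neg,
      neg_neg]
  set f₀ : L := φ y - y with hf₀
  set h : L := ⁅e, f₀⁆ with hh
  have hφh : φ h = h := by
    rw [hh, LieHom.map_lie, heφ, hf₀, map_sub, hφ, neg_lie, ← lie_neg, neg_sub]
  have hhe : ⁅h, e⁆ = (2 : ℝ) • e := by
    rw [← lie_skew, hh, hf₀, lie_sub, lie_sub, hy, hy']
    module
  obtain ⟨f, hhf, hef⟩ := exists_sl2_triple_of_lie_eq hnil hhe hh.symm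
  have hhf' : ⁅h, φ f⁆ = (-2 : ℝ) • φ f := by
    rw [← map_smul, ← hhf, LieHom.map_lie, hφh]
  have hef' : ⁅e, φ f⁆ = -h := by
    rw [← neg_eq_iff_eq_neg, ← neg_lie, ← heφ, ← LieHom.map_lie, hef, hφh]
  refine ⟨h, (2⁻¹ : ℝ) • (f - φ f), hφh, ?_, hhe, ?_, ?_⟩
  · rw [map_smul, map_sub, hφ]
    module
  · rw [lie_smul, lie_sub, hhf, hhf']
    module
  · rw [lie_smul, lie_sub, hef, hef']
    module
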